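/- arXiv:1510.06253 — 4 statements merged into one kernel-verified Lean document; each statement's English description precedes it below -/
import Mathlib

section
/- Let y ∈ ℝⁿ with Cy ≠ 0 and x ∈ ℝⁿ with Cx ≠ 0. Then the ratio of constrained to unconstrained residual sums of squares satisfies (min_{α∈ℝ, β≥0} ‖y − α·1ₙ − β·x‖²) / (min_{α∈ℝ} ‖y − α·1ₙ‖²) = 1 − 1{R>0}·R². Consequently, the likelihood-ratio statistic S for testing H₀: β = 0 against H₁: β ≥ 0 in the Gaussian linear model y ~ N(α·1ₙ + β·x, σ²·Iₙ), which equals this ratio raised to the power n/2, has the form S = (1 − 1{R>0}·R²)^{n/2}. -/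
open Matrix Finset

/-- The centering matrix `C = Iₙ − n⁻¹·1ₙ1ₙᵀ`. -/
noncomputable def Cmat (n : ℕ) : Matrix (Fin n) (Fin n) ℝ :=
  Matrix.of fun i j => (if i = j then 1 else 0) - 1 / n

/-- Euclidean norm on `ℝⁿ`. -/
noncomputable def enorm' {n : ℕ} (v : Fin n → ℝ) : ℝ := Real.sqrt (∑ i, v i ^ 2)

/-- The correlation coefficient `R = (Cx)ᵀ(Cy)/(‖Cx‖·‖Cy‖)`. -/
noncomputable def corrR {n : ℕ} (x y : Fin n → ℝ) : ℝ :=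
  ((Cmat n *ᵥ x) ⬝ᵥ (Cmat n *ᵥ y)) / (enorm' (Cmat n *ᵥ x) * enorm' (Cmat n *ᵥ y))

/-- Residual sum of squares minimized over `α ∈ ℝ`, `β ≥ 0`. -/
noncomputable def rss1 {n : ℕ} (x y : Fin n → ℝ) : ℝ :=
  sInf {t : ℝ | ∃ α β : ℝ, 0 ≤ β ∧
    t = enorm' (y - α • (fun _ => (1 : ℝ)) - β • x) ^ 2}

/-- Residual sum of squares minimized over `α ∈ ℝ` only. -/
noncomputable def rss0 {n : ℕ} (y : Fin n → ℝ) : ℝ :=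
  sInf {t : ℝ | ∃ α : ℝ, t = enorm' (y - α • (fun _ => (1 : ℝ))) ^ 2}

theorem enorm'_sq {n : ℕ} (v : Fin n → ℝ) : enorm' v ^ 2 = v ⬝ᵥ v := by
  rw [enorm', Real.sq_sqrt (by positivity)]
  simp [dotProduct, sq]

theorem Cmat_mulVec_apply {n : ℕ} (v : Fin n → ℝ) (i : Fin n) :
    (Cmat n *ᵥ v) i = v i - (∑ j, v j) / n := by
  simp [Cmat, mulVec, dotProduct, sub_mul, Finset.sum_sub_distrib, ← Finset.mul_sum]
  ring

theorem Cmat_mulVec_one {n : ℕ} (hn : n ≠ 0) : Cmat n *ᵥ (fun _ => (1 : ℝ)) = 0 := by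
  have : (n : ℝ) ≠ 0 := Nat.cast_ne_zero.mpr hn
  ext i
  simp [Cmat_mulVec_apply, this]

/-- Splitting off the component of `v` along the all-ones vector. -/
theorem enorm'_sq_eq_centered_add {n : ℕ} (hn : n ≠ 0) (v : Fin n → ℝ) :
    enorm' v ^ 2 = (Cmat n *ᵥ v) ⬝ᵥ (Cmat n *ᵥ v) + n * ((∑ j, v j) / n) ^ 2 := by
  have hn' : (n : ℝ) ≠ 0 := Nat.cast_ne_zero.mpr hn
  rw [enorm'_sq]
  simp only [dotProduct, Cmat_mulVec_apply]
  have h (i : Fin n) : (v i - (∑ j, v j) / n) * (v i - (∑ j, v j) / n) =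
      v i * v i - 2 * ((∑ j, v j) / n) * v i + ((∑ j, v j) / n) ^ 2 := by ring
  simp only [h, Finset.sum_add_distrib, Finset.sum_sub_distrib, ← Finset.mul_sum,
    Finset.sum_const, Finset.card_univ, Fintype.card_fin, nsmul_eq_mul]
  field_simp
  ring

theorem rss_expansion {n : ℕ} (hn : n ≠ 0) (x y : Fin n → ℝ) (α β : ℝ) :
    enorm' (y - α • (fun _ => (1 : ℝ)) - β • x) ^ 2 =
      (Cmat n *ᵥ y) ⬝ᵥ (Cmat n *ᵥ y) - 2 * β * ((Cmat n *ᵥ x) ⬝ᵥ (Cmat n *ᵥ y)) +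
        β ^ 2 * ((Cmat n *ᵥ x) ⬝ᵥ (Cmat n *ᵥ x)) +
        n * ((∑ j, y j) / n - α - β * ((∑ j, x j) / n)) ^ 2 := by
  have hn' : (n : ℝ) ≠ 0 := Nat.cast_ne_zero.mpr hn
  have hsum : (∑ j, (y - α • (fun _ => (1 : ℝ)) - β • x : Fin n → ℝ) j) / n =
      (∑ j, y j) / n - α - β * ((∑ j, x j) / n) := by
    simp [Finset.sum_sub_distrib, ← Finset.mul_sum]
    field_simp
  rw [enorm'_sq_eq_centered_add hn, hsum]
  simp only [mulVec_sub, mulVec_smul, Cmat_mulVec_one hn, smul_zero, sub_zero,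
    sub_dotProduct, dotProduct_sub, smul_dotProduct, dotProduct_smul, smul_eq_mul]
  rw [dotProduct_comm (Cmat n *ᵥ y) (Cmat n *ᵥ x)]
  ring

theorem rss0_eq {n : ℕ} (hn : n ≠ 0) (y : Fin n → ℝ) :
    rss0 y = (Cmat n *ᵥ y) ⬝ᵥ (Cmat n *ᵥ y) := by
  have h (α : ℝ) := rss_expansion hn 0 y α 0
  simp only [zero_smul, sub_zero] at h
  refine IsLeast.csInf_eq ⟨⟨(∑ j, y j) / n, ?_⟩, ?_⟩
  · rw [h]
    ring
  · rintro t ⟨α, rfl⟩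
    rw [h]
    have : 0 ≤ (n : ℝ) * ((∑ j, y j) / n - α - 0 * ((∑ j, (0 : Fin n → ℝ) j) / n)) ^ 2 := by
      positivity
    linarith

theorem rss1_eq_of_pos {n : ℕ} (hn : n ≠ 0) (x y : Fin n → ℝ)
    (ha : 0 < (Cmat n *ᵥ x) ⬝ᵥ (Cmat n *ᵥ x)) (hb : 0 < (Cmat n *ᵥ x) ⬝ᵥ (Cmat n *ᵥ y)) :
    rss1 x y = (Cmat n *ᵥ y) ⬝ᵥ (Cmat n *ᵥ y) -
      ((Cmat n *ᵥ x) ⬝ᵥ (Cmat n *ᵥ y)) ^ 2 / ((Cmat n *ᵥ x) ⬝ᵥ (Cmat n *ᵥ x)) := by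
  have h := rss_expansion hn x y
  set a := (Cmat n *ᵥ x) ⬝ᵥ (Cmat n *ᵥ x)
  set b := (Cmat n *ᵥ x) ⬝ᵥ (Cmat n *ᵥ y)
  refine IsLeast.csInf_eq
    ⟨⟨(∑ j, y j) / n - b / a * ((∑ j, x j) / n), b / a, by positivity, ?_⟩, ?_⟩
  · rw [h]
    field_simp
    ring
  · rintro t ⟨α, β, -, rfl⟩
    rw [h]
    have h₁ : 0 ≤ (n : ℝ) * ((∑ j, y j) / n - α - β * ((∑ j, x j) / n)) ^ 2 := by positivity
    have h₂ : 0 ≤ a * (β - b / a) ^ 2 := by positivity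
    have h₃ : a * (β - b / a) ^ 2 = β ^ 2 * a - 2 * β * b + b ^ 2 / a := by
      field_simp
      ring
    linarith

theorem rss1_eq_of_nonpos {n : ℕ} (hn : n ≠ 0) (x y : Fin n → ℝ)
    (hb : (Cmat n *ᵥ x) ⬝ᵥ (Cmat n *ᵥ y) ≤ 0) :
    rss1 x y = (Cmat n *ᵥ y) ⬝ᵥ (Cmat n *ᵥ y) := by
  have h := rss_expansion hn x y
  refine IsLeast.csInf_eq ⟨⟨(∑ j, y j) / n, 0, le_rfl, ?_⟩, ?_⟩
  · rw [h]
    ring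
  · rintro t ⟨α, β, hβ, rfl⟩
    rw [h]
    have h₁ : 0 ≤ (n : ℝ) * ((∑ j, y j) / n - α - β * ((∑ j, x j) / n)) ^ 2 := by positivity
    have h₂ : 0 ≤ β ^ 2 * ((Cmat n *ᵥ x) ⬝ᵥ (Cmat n *ᵥ x)) :=
      mul_nonneg (sq_nonneg _) (by rw [← enorm'_sq]; positivity)
    have h₃ := mul_nonpos_of_nonneg_of_nonpos hβ hb
    linarith

theorem enorm'_pos {n : ℕ} {v : Fin n → ℝ} (hv : v ≠ 0) : 0 < enorm' v := by
  refine (Real.sqrt_nonneg _).lt_of_ne' fun h => hv ?_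
  rw [← dotProduct_self_eq_zero, ← enorm'_sq]
  exact pow_eq_zero_iff two_ne_zero |>.mpr h

/-- the ratio of constrained to unconstrained residual sums of squares equals
`1 − 1{R>0}·R²`, and consequently the LR statistic `S = ratio^{n/2}` has the form
`(1 − 1{R>0}·R²)^{n/2}`. -/
theorem lr_statistic_form {n : ℕ} (hn : 3 ≤ n) (x y : Fin n → ℝ)
    (hx : Cmat n *ᵥ x ≠ 0) (hy : Cmat n *ᵥ y ≠ 0) :
    rss1 x y / rss0 y = 1 - (if 0 < corrR x y then corrR x y ^ 2 else 0) ∧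
    (rss1 x y / rss0 y) ^ ((n : ℝ) / 2) =
      (1 - (if 0 < corrR x y then corrR x y ^ 2 else 0)) ^ ((n : ℝ) / 2) := by
  have hn0 : n ≠ 0 := by omega
  have hxp := enorm'_pos hx
  have hyp := enorm'_pos hy
  have key : rss1 x y / rss0 y = 1 - (if 0 < corrR x y then corrR x y ^ 2 else 0) := by
    have hiff : 0 < corrR x y ↔ 0 < (Cmat n *ᵥ x) ⬝ᵥ (Cmat n *ᵥ y) :=
      div_pos_iff_of_pos_right (mul_pos hxp hyp)
    rw [rss0_eq hn0]
    split_ifs with h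
    · rw [rss1_eq_of_pos hn0 x y (by rw [← enorm'_sq]; positivity) (hiff.mp h), corrR,
        ← enorm'_sq, ← enorm'_sq]
      field_simp
    · rw [rss1_eq_of_nonpos hn0 x y (not_lt.mp (hiff.not.mp h)), ← enorm'_sq, sub_zero]
      exact div_self (by positivity)
  exact ⟨key, by rw [key]⟩
end

section
/- For every s ∈ 𝕊 and every r ∈ [0, 1], the uniform probability measure of the spherical cap satisfies ς(ℂ_{s,r}) = (1 − F(r²; 1/2, d/2))/2, where F(·; a, b) denotes the cumulative distribution function of the beta distribution with parameters a, b > 0. -/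
open MeasureTheory Filter
open scoped RealInnerProductSpace ENNReal

/-- `𝔼 d = ℝ^{d+1}` with the Euclidean structure. -/
abbrev Esp (d : ℕ) := EuclideanSpace ℝ (Fin (d + 1))

/-- The `d`-dimensional unit sphere `𝕊 = {s ∈ ℝ^{d+1} : ‖s‖ = 1}`. -/
abbrev Sph (d : ℕ) := Metric.sphere (0 : Esp d) 1

/-- The map on the sphere induced by a linear isometry (rotation/reflection) of `ℝ^{d+1}`. -/
noncomputable def sphMap {d : ℕ} (O : Esp d ≃ₗᵢ[ℝ] Esp d) (s : Sph d) : Sph d :=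
  ⟨O s, by
    have hs := mem_sphere_zero_iff_norm.mp s.2
    simp [mem_sphere_zero_iff_norm, O.norm_map, hs]⟩

/-- A measure on the sphere is rotation invariant if it is preserved by every
linear isometry of the ambient Euclidean space.  The uniform probability measure on the
sphere is the unique rotation-invariant Borel probability measure. -/
def RotInv {d : ℕ} (ς : Measure (Sph d)) : Prop :=
  ∀ O : Esp d ≃ₗᵢ[ℝ] Esp d, Measure.map (sphMap O) ς = ς

/-- The open spherical cap `ℂ_{s,r} = {t ∈ 𝕊 : sᵀt > r}`. -/
def Cap {d : ℕ} (s : Sph d) (r : ℝ) : Set (Sph d) :=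
  {t : Sph d | r < ⟪(s : Esp d), (t : Esp d)⟫}

/-- The CDF of the beta distribution with parameters `a, b > 0`. -/
noncomputable def betaCDF (a b t : ℝ) : ℝ :=
  (∫ x in (0 : ℝ)..t, x ^ (a - 1) * (1 - x) ^ (b - 1)) /
    (∫ x in (0 : ℝ)..1, x ^ (a - 1) * (1 - x) ^ (b - 1))

lemma exists_isometry_map_eq {d : ℕ} (s t : Sph d) :
    ∃ O : Esp d ≃ₗᵢ[ℝ] Esp d, O s = t := by
  refine ⟨(ℝ ∙ ((s : Esp d) - t))ᗮ.reflection, Submodule.reflection_sub ?_⟩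
  rw [mem_sphere_zero_iff_norm.mp s.2, mem_sphere_zero_iff_norm.mp t.2]

lemma measurableSet_cap {d : ℕ} (s : Sph d) (r : ℝ) : MeasurableSet (Cap s r) :=
  (isOpen_lt continuous_const (by fun_prop)).measurableSet

lemma RotInv.measure_cap_eq {d : ℕ} {ς : Measure (Sph d)} (hς : RotInv ς) (s t : Sph d) (r : ℝ) :
    ς (Cap s r) = ς (Cap t r) := by
  obtain ⟨O, hO⟩ := exists_isometry_map_eq s t
  have hcont : Continuous (sphMap O) :=
    Continuous.subtype_mk (O.continuous.comp continuous_subtype_val) _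
  rw [← hς O, Measure.map_apply hcont.measurable (measurableSet_cap t r), hς O]
  congr 1
  ext x
  simp [Cap, sphMap, ← hO]

/-- The part of the open unit ball lying in the open cone around `s` of level `r`. -/
def ballCone {d : ℕ} (s : Sph d) (r : ℝ) : Set (Esp d) :=
  {x | ‖x‖ < 1 ∧ r * ‖x‖ < ⟪(s : Esp d), x⟫}

lemma measurableSet_ballCone {d : ℕ} (s : Sph d) (r : ℝ) : MeasurableSet (ballCone s r) :=
  ((isOpen_lt continuous_norm continuous_const).inter
    (isOpen_lt (continuous_const.mul continuous_norm)
      (continuous_const.inner continuous_id))).measurableSet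

lemma volume_ballCone_eq {d : ℕ} (s t : Sph d) (r : ℝ) :
    volume (ballCone s r) = volume (ballCone t r) := by
  obtain ⟨O, hO⟩ := exists_isometry_map_eq s t
  rw [← O.measurePreserving.measure_preimage (measurableSet_ballCone t r).nullMeasurableSet]
  congr 1
  ext x
  simp [ballCone, ← hO]

lemma RotInv.measure_cap_mul_volume_ball {d : ℕ} {ς : Measure (Sph d)} [IsProbabilityMeasure ς]
    (hς : RotInv ς) (s : Sph d) (r : ℝ) :
    ς (Cap s r) * volume (Metric.ball (0 : Esp d) 1) = volume (ballCone s r) := by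
  set S : Set (Sph d × Esp d) := {p | r * ‖p.2‖ < ⟪(p.1 : Esp d), p.2⟫}
  have hS : MeasurableSet S := (isOpen_lt (by fun_prop) (by fun_prop)).measurableSet
  have hcone (t : Sph d) :
      (volume.restrict (Metric.ball (0 : Esp d) 1)) (Prod.mk t ⁻¹' S) = volume (ballCone s r) := by
    rw [Measure.restrict_apply (measurable_prodMk_left hS), volume_ballCone_eq s t]
    congr 1
    ext x
    simp [S, ballCone, and_comm]
  have hcap (x : Esp d) (hx : x ≠ 0) : ς ((fun t ↦ (t, x)) ⁻¹' S) = ς (Cap s r) := by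
    have hx' : 0 < ‖x‖ := norm_pos_iff.mpr hx
    have hmem : ‖x‖⁻¹ • x ∈ Metric.sphere (0 : Esp d) 1 := by
      simp [norm_smul, hx'.ne']
    rw [hς.measure_cap_eq s ⟨_, hmem⟩]
    congr 1
    ext t
    simp only [S, Cap, Set.mem_preimage, Set.mem_ofPred_eq, real_inner_smul_left]
    rw [real_inner_comm x, lt_inv_mul_iff₀ hx', mul_comm]
  have hleft := Measure.prod_apply (μ := ς)
    (ν := volume.restrict (Metric.ball (0 : Esp d) 1)) hS
  have hright := Measure.prod_apply_symm (μ := ς)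
    (ν := volume.restrict (Metric.ball (0 : Esp d) 1)) hS
  have hae : ∀ᵐ x ∂(volume.restrict (Metric.ball (0 : Esp d) 1)),
      ς ((fun t ↦ (t, x)) ⁻¹' S) = ς (Cap s r) := by
    refine ae_restrict_of_ae ?_
    filter_upwards [Measure.ae_ne volume (0 : Esp d)] with x hx using hcap x hx
  rw [lintegral_congr_ae hae] at hright
  simp only [hcone] at hleft
  rw [hleft] at hright
  simpa using hright.symm

lemma volume_ball_eq_two_mul_ballCone {d : ℕ} (s : Sph d) :
    volume (Metric.ball (0 : Esp d) 1) = 2 * volume (ballCone s 0) := by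
  have hs : ‖(s : Esp d)‖ = 1 := mem_sphere_zero_iff_norm.mp s.2
  have hnull : volume ((ℝ ∙ (s : Esp d))ᗮ : Set (Esp d)) = 0 := by
    refine Measure.addHaar_submodule _ _ fun h ↦ ?_
    have : (s : Esp d) ∈ (ℝ ∙ (s : Esp d))ᗮ := h ▸ Submodule.mem_top
    rw [Submodule.mem_orthogonal_singleton_iff_inner_right, real_inner_self_eq_norm_sq, hs] at this
    norm_num at this
  have hdisj : Disjoint (ballCone s 0) (ballCone (-s) 0) := by
    rw [Set.disjoint_left]
    rintro x ⟨-, h⟩ ⟨-, h'⟩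
    simp [inner_neg_left] at h h'
    linarith
  have hunion := measure_union (μ := volume) hdisj (measurableSet_ballCone (-s) 0)
  rw [volume_ballCone_eq (-s) s, ← two_mul] at hunion
  rw [← hunion]
  refine measure_congr (Filter.eventuallyEq_set.mpr ?_)
  have hne : ∀ᵐ x : Esp d, x ∉ ((ℝ ∙ (s : Esp d))ᗮ : Set (Esp d)) :=
    measure_eq_zero_iff_ae_notMem.mp hnull
  filter_upwards [hne] with x hx
  rw [SetLike.mem_coe, Submodule.mem_orthogonal_singleton_iff_inner_right] at hx
  simp [ballCone, inner_neg_left, ← and_or_left, lt_or_lt_iff_ne, Ne.symm hx]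

/-- The radius, at height `u`, of the section of the part of the unit ball of `ℝ^{d+1}` lying in
the cone of level `r`. -/
noncomputable def sectionRadius (r u : ℝ) : ℝ :=
  if u ≤ r then u * √(1 / r ^ 2 - 1) else √(1 - u ^ 2)

lemma sectionRadius_nonneg {r u : ℝ} (hu : 0 ≤ u) : 0 ≤ sectionRadius r u := by
  unfold sectionRadius
  split_ifs <;> positivity

lemma lt_sectionRadius_iff {r u t : ℝ} (hr : r ∈ Set.Icc (0 : ℝ) 1) (hu : 0 < u) (ht : 0 ≤ t) :
    (u ^ 2 + t ^ 2 < 1 ∧ r * √(u ^ 2 + t ^ 2) < u) ↔ u < 1 ∧ t < sectionRadius r u := by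
  have hsq : √(u ^ 2 + t ^ 2) ^ 2 = u ^ 2 + t ^ 2 := Real.sq_sqrt (by positivity)
  have hcone : r * √(u ^ 2 + t ^ 2) < u ↔ r ^ 2 * (u ^ 2 + t ^ 2) < u ^ 2 := by
    rw [← sq_lt_sq₀ (mul_nonneg hr.1 (Real.sqrt_nonneg _)) hu.le, mul_pow, hsq]
  rw [hcone, sectionRadius]
  split_ifs with hur
  · have hr0 : 0 < r := hu.trans_le hur
    have hinv : 0 ≤ 1 / r ^ 2 - 1 := by
      rw [sub_nonneg, le_div_iff₀ (by positivity)]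
      nlinarith [hr.1, hr.2]
    have hrad : t < u * √(1 / r ^ 2 - 1) ↔ r ^ 2 * (u ^ 2 + t ^ 2) < u ^ 2 := by
      rw [← sq_lt_sq₀ ht (by positivity), mul_pow, Real.sq_sqrt hinv]
      have : u ^ 2 * (1 / r ^ 2 - 1) = (u ^ 2 - r ^ 2 * u ^ 2) / r ^ 2 := by field_simp
      rw [this, lt_div_iff₀ (by positivity)]
      constructor <;> intro h <;> linarith
    rw [hrad]
    refine and_congr_left fun h ↦ ⟨fun h' ↦ by nlinarith, fun h' ↦ ?_⟩
    have h2 : u ^ 2 ≤ r ^ 2 := by gcongr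
    have h3 : r ^ 2 * (u ^ 2 + t ^ 2) < r ^ 2 * 1 := by linarith
    exact lt_of_mul_lt_mul_left h3 (by positivity)
  · rw [Real.lt_sqrt ht]
    push Not at hur
    constructor
    · rintro ⟨h, -⟩
      exact ⟨by nlinarith, by linarith⟩
    · rintro ⟨h, h'⟩
      refine ⟨by linarith, ?_⟩
      have h2 : r ^ 2 < u ^ 2 := by gcongr; exact hr.1
      nlinarith

lemma volume_ballCone_eq_lintegral {d : ℕ} (hd : 1 ≤ d) {r : ℝ} (hr : r ∈ Set.Icc (0 : ℝ) 1)
    (s : Sph d) :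
    volume (ballCone s r) =
      (∫⁻ u in Set.Ioo (0 : ℝ) 1, ENNReal.ofReal (sectionRadius r u ^ d)) *
        volume (Metric.ball (0 : EuclideanSpace ℝ (Fin d)) 1) := by
  have : Nonempty (Fin d) := ⟨⟨0, hd⟩⟩
  have hmem : EuclideanSpace.single (0 : Fin (d + 1)) (1 : ℝ) ∈ Metric.sphere (0 : Esp d) 1 := by
    simp
  rw [volume_ballCone_eq s ⟨_, hmem⟩]
  have hsplit : MeasurePreserving
      (fun p : ℝ × EuclideanSpace ℝ (Fin d) ↦
        (WithLp.toLp 2 (Fin.cons p.1 p.2.ofLp : Fin (d + 1) → ℝ) : Esp d)) := by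
    have h := (PiLp.volume_preserving_toLp (Fin (d + 1))).comp
      ((volume_preserving_piFinSuccAbove (fun _ : Fin (d + 1) ↦ ℝ) 0).symm.comp
        ((MeasurePreserving.id volume).prod (PiLp.volume_preserving_ofLp (Fin d))))
    convert! h using 2 with p
    simp [MeasurableEquiv.piFinSuccAbove, Fin.insertNthEquiv]
  rw [← hsplit.measure_preimage (measurableSet_ballCone _ r).nullMeasurableSet,
    Measure.volume_eq_prod,
    Measure.prod_apply (hsplit.measurable (measurableSet_ballCone _ r)),
    ← lintegral_mul_const' _ _ measure_ball_lt_top.ne, ← lintegral_indicator measurableSet_Ioo]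
  refine lintegral_congr fun u ↦ ?_
  have hpre : ∀ y : EuclideanSpace ℝ (Fin d),
      (WithLp.toLp 2 (Fin.cons u y.ofLp : Fin (d + 1) → ℝ) : Esp d) ∈ ballCone ⟨_, hmem⟩ r ↔
        u ^ 2 + ‖y‖ ^ 2 < 1 ∧ r * √(u ^ 2 + ‖y‖ ^ 2) < u := by
    intro y
    have hnorm : ‖(WithLp.toLp 2 (Fin.cons u y.ofLp : Fin (d + 1) → ℝ) : Esp d)‖
        = √(u ^ 2 + ‖y‖ ^ 2) := by
      rw [EuclideanSpace.norm_eq, EuclideanSpace.norm_sq_eq, Fin.sum_univ_succ]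
      simp
    simp only [ballCone, Set.mem_ofPred_eq, hnorm, EuclideanSpace.inner_single_left]
    rw [Real.sqrt_lt' one_pos]
    simp
  by_cases hu : u ∈ Set.Ioo (0 : ℝ) 1
  · rw [Set.indicator_of_mem hu]
    have hball : Prod.mk u ⁻¹' ((fun p : ℝ × EuclideanSpace ℝ (Fin d) ↦
        (WithLp.toLp 2 (Fin.cons p.1 p.2.ofLp : Fin (d + 1) → ℝ) : Esp d)) ⁻¹'
          ballCone ⟨_, hmem⟩ r) = Metric.ball 0 (sectionRadius r u) := by
      ext y
      rw [Set.mem_preimage, Set.mem_preimage, hpre,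
        lt_sectionRadius_iff hr hu.1 (norm_nonneg y), mem_ball_zero_iff]
      simp [hu.2]
    rw [hball, Measure.addHaar_ball _ _ (sectionRadius_nonneg hu.1.le), finrank_euclideanSpace_fin]
  · rw [Set.indicator_of_notMem hu, measure_eq_zero_iff_ae_notMem]
    refine ae_of_all _ fun y hy ↦ hu ?_
    obtain ⟨h1, h2⟩ := (hpre y).mp hy
    have hu0 : 0 < u := lt_of_le_of_lt (mul_nonneg hr.1 (Real.sqrt_nonneg _)) h2
    exact ⟨hu0, by nlinarith [sq_nonneg ‖y‖]⟩

lemma intervalIntegrable_one_sub_sq_rpow {d : ℕ} (hd : 1 ≤ d) {a b : ℝ}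
    (ha : a ∈ Set.Icc (0 : ℝ) 1) (hb : b ∈ Set.Icc (0 : ℝ) 1) :
    IntervalIntegrable (fun u : ℝ ↦ (1 - u ^ 2) ^ ((d : ℝ) / 2 - 1)) volume a b := by
  have hd' : (1 : ℝ) ≤ d := by exact_mod_cast hd
  have hsub : Set.uIcc a b ⊆ Set.Icc 0 1 := Set.uIcc_subset_Icc ha hb
  have h1 : IntervalIntegrable (fun u : ℝ ↦ (1 - u) ^ ((d : ℝ) / 2 - 1)) volume a b := by
    have h := (intervalIntegral.intervalIntegrable_rpow' (a := 1 - a) (b := 1 - b)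
      (r := (d : ℝ) / 2 - 1) (by linarith)).comp_sub_left 1
    simpa using h
  have h2 : ContinuousOn (fun u : ℝ ↦ (1 + u) ^ ((d : ℝ) / 2 - 1)) (Set.uIcc a b) := by
    refine ContinuousOn.rpow_const (by fun_prop) fun x hx ↦ Or.inl ?_
    have := (hsub hx).1
    positivity
  refine (h1.mul_continuousOn h2).congr fun u hu ↦ ?_
  have hu' := hsub (Set.uIoc_subset_uIcc hu)
  change (1 - u) ^ _ * (1 + u) ^ _ = _
  rw [← Real.mul_rpow (by linarith [hu'.2]) (by linarith [hu'.1])]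
  congr 1
  ring

lemma integral_beta_sq {b r : ℝ} (hr : 0 ≤ r) :
    ∫ x in (0 : ℝ)..r ^ 2, x ^ ((1 : ℝ) / 2 - 1) * (1 - x) ^ b =
      2 * ∫ u in (0 : ℝ)..r, (1 - u ^ 2) ^ b := by
  have himage : (fun u : ℝ ↦ u ^ 2) '' Set.Ioo 0 r = Set.Ioo 0 (r ^ 2) := by
    ext x
    constructor
    · rintro ⟨u, hu, rfl⟩
      have := hu.1
      exact ⟨by positivity, by have := hu.2; dsimp only; gcongr⟩
    · intro hx
      exact ⟨√x, ⟨Real.sqrt_pos.mpr hx.1, (Real.sqrt_lt hx.1.le hr).mpr hx.2⟩,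
        Real.sq_sqrt hx.1.le⟩
  have hinj : Set.InjOn (fun u : ℝ ↦ u ^ 2) (Set.Ioo 0 r) := fun x hx y hy h ↦
    (pow_left_inj₀ hx.1.le hy.1.le two_ne_zero).mp h
  rw [intervalIntegral.integral_of_le (by positivity), intervalIntegral.integral_of_le hr,
    integral_Ioc_eq_integral_Ioo, integral_Ioc_eq_integral_Ioo, ← himage,
    integral_image_eq_integral_abs_deriv_smul (f' := fun u ↦ 2 * u) measurableSet_Ioo
      (fun x _ ↦ by simpa using (hasDerivAt_pow 2 x).hasDerivWithinAt) hinj,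
    ← integral_const_mul]
  refine setIntegral_congr_fun measurableSet_Ioo fun u hu ↦ ?_
  have hu0 : 0 < u := hu.1
  have hpow : (u ^ 2) ^ ((1 : ℝ) / 2 - 1) = u⁻¹ := by
    rw [← Real.rpow_natCast, ← Real.rpow_mul hu0.le, ← Real.rpow_neg_one]
    norm_num
  simp only [smul_eq_mul, hpow]
  rw [abs_of_pos (by positivity)]
  field_simp

lemma integral_one_sub_sq_recursion {d : ℕ} (hd : 1 ≤ d) {r : ℝ} (hr : r ∈ Set.Icc (0 : ℝ) 1) :
    r * √(1 - r ^ 2) ^ d + (d + 1) * ∫ u in r..1, √(1 - u ^ 2) ^ d =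
      d * ∫ u in r..1, (1 - u ^ 2) ^ ((d : ℝ) / 2 - 1) := by
  have hI1 : IntervalIntegrable (fun u : ℝ ↦ √(1 - u ^ 2) ^ d) volume r 1 :=
    Continuous.intervalIntegrable (by fun_prop) _ _
  have hI2 := intervalIntegrable_one_sub_sq_rpow hd hr (b := 1) (by simp)
  have hint := (hI1.const_mul ((d : ℝ) + 1)).sub (hI2.const_mul (d : ℝ))
  have hderiv : ∀ u ∈ Set.Ioo r 1, HasDerivAt (fun u : ℝ ↦ u * √(1 - u ^ 2) ^ d)
      (((d : ℝ) + 1) * √(1 - u ^ 2) ^ d - d * (1 - u ^ 2) ^ ((d : ℝ) / 2 - 1)) u := by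
    intro u hu
    have hpos : 0 < 1 - u ^ 2 := by nlinarith [hu.1, hu.2, hr.1]
    have hrpow : ∀ v : ℝ, 0 < 1 - v ^ 2 → √(1 - v ^ 2) ^ d = (1 - v ^ 2) ^ ((d : ℝ) / 2) := by
      intro v hv
      rw [Real.sqrt_eq_rpow, ← Real.rpow_mul_natCast hv.le]
      congr 1
      ring
    have hbase : HasDerivAt (fun v : ℝ ↦ 1 - v ^ 2) (-(2 * u)) u := by
      simpa using (hasDerivAt_pow 2 u).const_sub 1
    have h := (hasDerivAt_id u).mul (hbase.rpow_const (p := (d : ℝ) / 2) (Or.inl hpos.ne'))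
    have heq : (fun v : ℝ ↦ v * √(1 - v ^ 2) ^ d) =ᶠ[nhds u]
        (id * fun v : ℝ ↦ (1 - v ^ 2) ^ ((d : ℝ) / 2)) := by
      filter_upwards [hbase.continuousAt.eventually (lt_mem_nhds hpos)] with v hv
      simp [hrpow v hv]
    refine (h.congr_of_eventuallyEq heq).congr_deriv ?_
    have hsplit : (1 - u ^ 2) ^ ((d : ℝ) / 2) =
        (1 - u ^ 2) ^ ((d : ℝ) / 2 - 1) * (1 - u ^ 2) := by
      rw [← Real.rpow_add_one hpos.ne']
      congr 1
      ring
    rw [hrpow u hpos, hsplit]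
    simp only [id]
    ring
  have hFTC := intervalIntegral.integral_eq_sub_of_hasDerivAt_of_le hr.2
    (Continuous.continuousOn (by fun_prop)) hderiv hint
  rw [intervalIntegral.integral_sub (hI1.const_mul _) (hI2.const_mul _),
    intervalIntegral.integral_const_mul, intervalIntegral.integral_const_mul] at hFTC
  have hd0 : d ≠ 0 := by omega
  simp [hd0] at hFTC
  linarith

lemma integral_sectionRadius_pow {d : ℕ} (hd : 1 ≤ d) {r : ℝ} (hr : r ∈ Set.Icc (0 : ℝ) 1) :
    IntervalIntegrable (fun u ↦ sectionRadius r u ^ d) volume 0 1 ∧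
      ∫ u in (0 : ℝ)..1, sectionRadius r u ^ d =
        d / (d + 1) * ∫ u in r..1, (1 - u ^ 2) ^ ((d : ℝ) / 2 - 1) := by
  have hlow : Set.EqOn (fun u : ℝ ↦ u ^ d * √(1 / r ^ 2 - 1) ^ d)
      (fun u ↦ sectionRadius r u ^ d) (Set.uIoc 0 r) := by
    intro u hu
    rw [Set.uIoc_of_le hr.1] at hu
    simp [sectionRadius, hu.2, mul_pow]
  have hhigh : Set.EqOn (fun u : ℝ ↦ √(1 - u ^ 2) ^ d)
      (fun u ↦ sectionRadius r u ^ d) (Set.uIoc r 1) := by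
    intro u hu
    rw [Set.uIoc_of_le hr.2] at hu
    simp [sectionRadius, hu.1.not_ge]
  have hIlow : IntervalIntegrable (fun u : ℝ ↦ u ^ d * √(1 / r ^ 2 - 1) ^ d) volume 0 r :=
    Continuous.intervalIntegrable (by fun_prop) _ _
  have hIhigh : IntervalIntegrable (fun u : ℝ ↦ √(1 - u ^ 2) ^ d) volume r 1 :=
    Continuous.intervalIntegrable (by fun_prop) _ _
  have h1 := hIlow.congr hlow
  have h2 := hIhigh.congr hhigh
  refine ⟨h1.trans h2, ?_⟩
  rw [← intervalIntegral.integral_add_adjacent_intervals h1 h2,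
    ← intervalIntegral.integral_congr_ae (ae_of_all _ fun u hu ↦ hlow hu),
    ← intervalIntegral.integral_congr_ae (ae_of_all _ fun u hu ↦ hhigh hu),
    intervalIntegral.integral_mul_const, integral_pow]
  have hrec := integral_one_sub_sq_recursion hd hr
  have hscale : r ^ (d + 1) * √(1 / r ^ 2 - 1) ^ d = r * √(1 - r ^ 2) ^ d := by
    rcases hr.1.eq_or_lt with rfl | h0
    · simp
    · have : r * √(1 / r ^ 2 - 1) = √(1 - r ^ 2) := by
        nth_rewrite 1 [← Real.sqrt_sq h0.le]
        rw [← Real.sqrt_mul (by positivity)]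
        congr 1
        field_simp
      rw [← this]
      ring
  have hd1 : (d : ℝ) + 1 ≠ 0 := by positivity
  rw [div_mul_eq_mul_div (d : ℝ), ← hrec, ← hscale]
  field_simp
  simp

lemma volume_real_ballCone {d : ℕ} (hd : 1 ≤ d) {r : ℝ} (hr : r ∈ Set.Icc (0 : ℝ) 1)
    (s : Sph d) :
    volume.real (ballCone s r) =
      d / (d + 1) * (∫ u in r..1, (1 - u ^ 2) ^ ((d : ℝ) / 2 - 1)) *
        volume.real (Metric.ball (0 : EuclideanSpace ℝ (Fin d)) 1) := by
  obtain ⟨hint, heq⟩ := integral_sectionRadius_pow hd hr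
  have hnonneg : 0 ≤ᵐ[volume.restrict (Set.Ioo (0 : ℝ) 1)] fun u ↦ sectionRadius r u ^ d := by
    filter_upwards [ae_restrict_mem measurableSet_Ioo] with u hu
    exact pow_nonneg (sectionRadius_nonneg hu.1.le) d
  rw [intervalIntegrable_iff_integrableOn_Ioo_of_le zero_le_one] at hint
  rw [intervalIntegral.integral_of_le zero_le_one, integral_Ioc_eq_integral_Ioo] at heq
  rw [measureReal_def, volume_ballCone_eq_lintegral hd hr,
    ← ofReal_integral_eq_lintegral_ofReal hint hnonneg, ENNReal.toReal_mul,
    ENNReal.toReal_ofReal (integral_nonneg_of_ae hnonneg), heq, measureReal_def]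

/-- for every `s ∈ 𝕊` and `r ∈ [0, 1]`, the uniform probability measure of
the spherical cap satisfies `ς(ℂ_{s,r}) = (1 − F(r²; 1/2, d/2))/2`, where `F(·; a, b)` is
the beta CDF. -/
theorem cap_measure_eq_beta {d : ℕ} (hd : 1 ≤ d)
    (ς : Measure (Sph d)) [IsProbabilityMeasure ς] (hς : RotInv ς)
    (s : Sph d) (r : ℝ) (hr : r ∈ Set.Icc (0 : ℝ) 1) :
    (ς (Cap s r)).toReal = (1 - betaCDF (1 / 2) ((d : ℝ) / 2) (r ^ 2)) / 2 := by
  have h0 : (0 : ℝ) ∈ Set.Icc (0 : ℝ) 1 := by simp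
  have h1 : (1 : ℝ) ∈ Set.Icc (0 : ℝ) 1 := by simp
  have : Nonempty (Fin d) := ⟨⟨0, hd⟩⟩
  have hball : 0 < volume.real (Metric.ball (0 : Esp d) 1) :=
    ENNReal.toReal_pos (Metric.measure_ball_pos _ _ one_pos).ne' measure_ball_lt_top.ne
  have hcap := congrArg ENNReal.toReal (hς.measure_cap_mul_volume_ball s r)
  have htwo := congrArg ENNReal.toReal (volume_ball_eq_two_mul_ballCone s)
  rw [ENNReal.toReal_mul, ← measureReal_def volume, ← measureReal_def volume,
    volume_real_ballCone hd hr] at hcap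
  rw [ENNReal.toReal_mul, ← measureReal_def, ← measureReal_def, volume_real_ballCone hd h0] at htwo
  have hadd := intervalIntegral.integral_add_adjacent_intervals
    (intervalIntegrable_one_sub_sq_rpow hd h0 hr) (intervalIntegrable_one_sub_sq_rpow hd hr h1)
  have hbeta1 := integral_beta_sq (b := (d : ℝ) / 2 - 1) zero_le_one
  rw [one_pow] at hbeta1
  rw [betaCDF, integral_beta_sq hr.1, hbeta1, ← hadd]
  rw [← hadd] at htwo
  rw [htwo] at hcap hball
  set A := ∫ u in (0 : ℝ)..r, (1 - u ^ 2) ^ ((d : ℝ) / 2 - 1)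
  set B := ∫ u in r..1, (1 - u ^ 2) ^ ((d : ℝ) / 2 - 1)
  set c := volume.real (Metric.ball (0 : EuclideanSpace ℝ (Fin d)) 1)
  have hAB : A + B ≠ 0 := by
    intro h
    simp [h] at hball
  have hc : c ≠ 0 := by
    intro h
    simp [h] at hball
  have hd0 : (d : ℝ) ≠ 0 := by positivity
  have hd1 : (d : ℝ) + 1 ≠ 0 := by positivity
  rw [ENNReal.toReal_ofNat] at hcap
  field_simp at hcap ⊢
  linarith
end

section
/- For d ≥ 1 and λ ∈ ℕ, define φ_λ : [0, 2π] → [0, 2π]^d by φ_λ(γ) = (γ mod 2π, λγ mod 2π, λ²γ mod 2π, …, λ^{d−1}γ mod 2π). Then sup_{ψ ∈ [0,2π]^d} inf_{γ ∈ [0,2π]} ‖ψ − φ_λ(γ)‖ → 0 as λ → ∞, i.e., the curve φ_λ becomes dense in [0, 2π]^d uniformly in the limit λ → ∞. -/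
open Filter

/-- `a mod 2π`: the representative of `a` modulo `2π` in `[0, 2π)`. -/
noncomputable def mod2pi (a : ℝ) : ℝ := a - 2 * Real.pi * ⌊a / (2 * Real.pi)⌋

/-- The curve `φ_λ(γ) = (γ mod 2π, λγ mod 2π, …, λ^{d−1}γ mod 2π)`. -/
noncomputable def phiCurve (d : ℕ) (l : ℕ) (γ : ℝ) : Fin d → ℝ :=
  fun k => mod2pi ((l : ℝ) ^ (k : ℕ) * γ)

open Real in
theorem mod2pi_two_pi_mul (t : ℝ) : mod2pi (2 * π * t) = 2 * π * Int.fract t := by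
  rw [mod2pi, mul_div_cancel_left₀ t two_pi_pos.ne', Int.fract]
  ring

/-- Every `y ∈ [0, 1]` lies in one of the intervals `[a / l, (a + 1) / l]` with `a < l`. -/
theorem exists_nat_lt_le_mul_le {l : ℕ} (hl : 0 < l) {y : ℝ} (hy : y ∈ Set.Icc (0 : ℝ) 1) :
    ∃ a < l, (a : ℝ) ≤ l * y ∧ l * y ≤ a + 1 := by
  have hl' : (0 : ℝ) < l := by exact_mod_cast hl
  rcases hy.2.eq_or_lt with rfl | h
  · refine ⟨l - 1, by omega, ?_⟩
    rw [Nat.cast_pred hl]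
    constructor <;> linarith
  · have h0 : 0 ≤ l * y := mul_nonneg hl'.le hy.1
    exact ⟨⌊l * y⌋₊, (Nat.floor_lt h0).2 (by nlinarith), Nat.floor_le h0,
      (Nat.lt_floor_add_one _).le⟩

/-- Prescribing the leading base-`l` digits of `x` makes the fractional parts of
`x, l x, …, l ^ (d - 1) x` simultaneously `1 / l`-close to arbitrary targets in `[0, 1]`. -/
theorem exists_abs_sub_fract_pow_mul_le {l : ℕ} (hl : 0 < l) (d : ℕ) (y : ℕ → ℝ)
    (hy : ∀ k < d, y k ∈ Set.Icc (0 : ℝ) 1) :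
    ∃ x ∈ Set.Ico (0 : ℝ) 1, ∀ k < d, |y k - Int.fract ((l : ℝ) ^ k * x)| ≤ 1 / l := by
  have hl' : (0 : ℝ) < l := by exact_mod_cast hl
  induction d generalizing y with
  | zero => exact ⟨0, by simp, by simp⟩
  | succ d ih =>
    obtain ⟨x, hx, hxy⟩ := ih (fun k => y (k + 1)) fun k hk => hy _ (by omega)
    obtain ⟨a, hal, ha, ha'⟩ := exists_nat_lt_le_mul_le hl (hy 0 (by omega))
    have hal' : (a : ℝ) + 1 ≤ l := by exact_mod_cast hal
    have hmem : (a + x) / l ∈ Set.Ico (0 : ℝ) 1 :=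
      ⟨div_nonneg (add_nonneg a.cast_nonneg hx.1) hl'.le,
        (div_lt_one hl').2 (by linarith [hx.2])⟩
    refine ⟨(a + x) / l, hmem, fun k hk => ?_⟩
    cases k with
    | zero =>
      rw [pow_zero, one_mul, Int.fract_eq_self.2 hmem, le_div_iff₀ hl',
        ← abs_of_pos hl', ← abs_mul, abs_of_pos hl', sub_mul, div_mul_cancel₀ _ hl'.ne', abs_le]
      constructor <;> linarith [hx.1, hx.2]
    | succ k =>
      have hshift : (l : ℝ) ^ (k + 1) * ((a + x) / l) = ((l ^ k * a : ℕ) : ℝ) + l ^ k * x := by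
        push_cast
        field_simp
        ring
      rw [hshift, Int.fract_natCast_add]
      exact hxy k (by omega)

open Real in
theorem exists_sqrt_sum_sub_phiCurve_le {l : ℕ} (hl : 0 < l) {d : ℕ} {ψ : Fin d → ℝ}
    (hψ : ∀ k, ψ k ∈ Set.Icc 0 (2 * π)) :
    ∃ γ ∈ Set.Icc 0 (2 * π),
      √(∑ k, (ψ k - phiCurve d l γ k) ^ 2) ≤ √(d * (2 * π / l) ^ 2) := by
  have hpi := two_pi_pos
  obtain ⟨x, hx, hxy⟩ := exists_abs_sub_fract_pow_mul_le hl d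
    (fun k => if h : k < d then ψ ⟨k, h⟩ / (2 * π) else 0) fun k hk => by
      simp only [hk, dite_true]
      exact ⟨div_nonneg (hψ _).1 hpi.le, (div_le_one hpi).2 (hψ _).2⟩
  refine ⟨2 * π * x, ⟨mul_nonneg hpi.le hx.1, mul_le_of_le_one_right hpi.le hx.2.le⟩,
    sqrt_le_sqrt ?_⟩
  refine (Finset.sum_le_card_nsmul _ _ ((2 * π / l) ^ 2) fun k _ => ?_).trans (by simp)
  have hk := hxy k k.2
  simp only [k.2, dite_true, Fin.eta] at hk
  have hcoord : ψ k - phiCurve d l (2 * π * x) k =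
      2 * π * (ψ k / (2 * π) - Int.fract ((l : ℝ) ^ (k : ℕ) * x)) := by
    rw [phiCurve, mul_left_comm, mod2pi_two_pi_mul, mul_sub, mul_div_cancel₀ _ hpi.ne']
  rw [hcoord, sq_le_sq, abs_mul, abs_of_pos hpi, abs_of_pos (by positivity : 0 < 2 * π / l),
    div_eq_mul_one_div (2 * π)]
  exact mul_le_mul_of_nonneg_left hk hpi.le

/-- `sup_{ψ ∈ [0,2π]^d} inf_{γ ∈ [0,2π]} ‖ψ − φ_λ(γ)‖ → 0` as `λ → ∞`,
i.e. the curves `φ_λ` become dense in `[0, 2π]^d` uniformly in the limit. -/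
theorem curve_dense_in_box {d : ℕ} (hd : 1 ≤ d) :
    Tendsto
      (fun l : ℕ =>
        ⨆ ψ : (Set.Icc (fun _ => (0 : ℝ)) (fun _ => 2 * Real.pi) : Set (Fin d → ℝ)),
          ⨅ γ : Set.Icc (0 : ℝ) (2 * Real.pi),
            Real.sqrt (∑ k, ((ψ : Fin d → ℝ) k - phiCurve d l (γ : ℝ) k) ^ 2))
      atTop (nhds 0) := by
  have hbound : Tendsto (fun l : ℕ => Real.sqrt (d * (2 * Real.pi / l) ^ 2)) atTop (nhds 0) := by
    simpa using (((tendsto_const_div_atTop_nhds_zero_nat (2 * Real.pi)).pow 2).const_mul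
      (d : ℝ)).sqrt
  refine tendsto_of_tendsto_of_tendsto_of_le_of_le' tendsto_const_nhds hbound
    (.of_forall fun l => Real.iSup_nonneg fun ψ => Real.iInf_nonneg fun γ => Real.sqrt_nonneg _) ?_
  filter_upwards [eventually_gt_atTop 0] with l hl
  refine Real.iSup_le (fun ψ => ?_) (Real.sqrt_nonneg _)
  obtain ⟨γ, hγ, hle⟩ := exists_sqrt_sum_sub_phiCurve_le hl
    (ψ := ψ) fun k => ⟨ψ.2.1 k, ψ.2.2 k⟩
  exact ciInf_le_of_le ⟨0, Set.forall_mem_range.2 fun _ => Real.sqrt_nonneg _⟩ ⟨γ, hγ⟩ hle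
end

section
/- For d ≥ 1 and λ ∈ ℕ, define the curve γ ↦ x̃_γ ∈ ℝ^{d+1} on Γ = [0, 2π] by x̃_γ^{(k)} = cos(1{k>1}·λ^{k−2}·γ) · ∏_{ℓ=k}^{d} sin(λ^{ℓ−1}·γ) for k = 1, …, d+1 (so that x̃_γ ∈ 𝕊 are the Cartesian coordinates of the point with spherical coordinates γ, λγ, …, λ^{d−1}γ). Then inf_{y ∈ 𝕊} sup_{γ ∈ Γ} yᵀx̃_γ → 1 as λ → ∞. -/
open Filter Finset

/-- The spherical curve with Cartesian coordinates
`x̃_γ^{(k)} = cos(1{k>1}·λ^{k−2}·γ) · ∏_{ℓ=k}^{d} sin(λ^{ℓ−1}·γ)`, `k = 1, …, d+1`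
(indexed here by `k = 0, …, d`), i.e. the point with spherical coordinates
`γ, λγ, …, λ^{d−1}γ`. -/
noncomputable def curveX (d : ℕ) (l : ℕ) (γ : ℝ) : Fin (d + 1) → ℝ :=
  fun k =>
    Real.cos (if 0 < (k : ℕ) then (l : ℝ) ^ ((k : ℕ) - 1) * γ else 0) *
      ∏ j ∈ Finset.Ico (k : ℕ) d, Real.sin ((l : ℝ) ^ j * γ)

/-- The `k`-th Cartesian coordinate of the point of the unit sphere of `ℝ^{d+1}` with spherical
coordinates `θ 0, …, θ (d - 1)`. -/
noncomputable def sphericalCoord (d : ℕ) (θ : ℕ → ℝ) (k : ℕ) : ℝ :=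
  Real.cos (if 0 < k then θ (k - 1) else 0) * ∏ j ∈ Finset.Ico k d, Real.sin (θ j)

lemma curveX_eq_sphericalCoord (d l : ℕ) (γ : ℝ) (k : Fin (d + 1)) :
    curveX d l γ k = sphericalCoord d (fun j => (l : ℝ) ^ j * γ) k := rfl

lemma sphericalCoord_succ_of_le {d k : ℕ} (hk : k ≤ d) (θ : ℕ → ℝ) :
    sphericalCoord (d + 1) θ k = sphericalCoord d θ k * Real.sin (θ d) := by
  simp only [sphericalCoord, Finset.prod_Ico_succ_top hk, mul_assoc]

lemma sphericalCoord_succ_self (d : ℕ) (θ : ℕ → ℝ) :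
    sphericalCoord (d + 1) θ (d + 1) = Real.cos (θ d) := by
  simp [sphericalCoord]

lemma sphericalCoord_congr {d k : ℕ} (hk : k ≤ d) {θ φ : ℕ → ℝ} (h : ∀ j < d, θ j = φ j) :
    sphericalCoord d θ k = sphericalCoord d φ k := by
  unfold sphericalCoord
  congr 1
  · split_ifs with h0
    · rw [h _ (by omega)]
    · rfl
  · exact Finset.prod_congr rfl fun j hj => by rw [h j (Finset.mem_Ico.1 hj).2]

lemma abs_one_sub_sum_sphericalCoord_mul_le (d : ℕ) (θ φ : ℕ → ℝ) :
    |1 - ∑ k ∈ range (d + 1), sphericalCoord d θ k * sphericalCoord d φ k| ≤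
      ∑ j ∈ range d, (1 - Real.cos (θ j - φ j)) := by
  induction d with
  | zero => simp [sphericalCoord]
  | succ d ih =>
    have hsum : ∑ k ∈ range (d + 1), sphericalCoord (d + 1) θ k * sphericalCoord (d + 1) φ k =
        Real.sin (θ d) * Real.sin (φ d) *
          ∑ k ∈ range (d + 1), sphericalCoord d θ k * sphericalCoord d φ k := by
      rw [Finset.mul_sum]
      refine Finset.sum_congr rfl fun k hk => ?_
      have hk' : k ≤ d := Nat.lt_succ_iff.1 (Finset.mem_range.1 hk)
      rw [sphericalCoord_succ_of_le hk', sphericalCoord_succ_of_le hk']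
      ring
    rw [Finset.sum_range_succ, hsum, sphericalCoord_succ_self, sphericalCoord_succ_self,
      Finset.sum_range_succ (fun j => 1 - Real.cos (θ j - φ j)) d]
    set I := ∑ k ∈ range (d + 1), sphericalCoord d θ k * sphericalCoord d φ k
    have hs : |Real.sin (θ d) * Real.sin (φ d)| ≤ 1 := by
      rw [abs_mul]
      exact mul_le_one₀ (Real.abs_sin_le_one _) (abs_nonneg _) (Real.abs_sin_le_one _)
    have hc : 0 ≤ 1 - Real.cos (θ d - φ d) := sub_nonneg.2 (Real.cos_le_one _)
    calc _ = |Real.sin (θ d) * Real.sin (φ d) * (1 - I) + (1 - Real.cos (θ d - φ d))| := by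
          rw [Real.cos_sub]; congr 1; ring
      _ ≤ |Real.sin (θ d) * Real.sin (φ d)| * |1 - I| + (1 - Real.cos (θ d - φ d)) := by
          rw [← abs_mul]
          exact (abs_add_le _ _).trans_eq (by rw [abs_of_nonneg hc])
      _ ≤ _ := by
          gcongr
          exact (mul_le_of_le_one_left (abs_nonneg _) hs).trans ih

lemma sum_sphericalCoord_sq (d : ℕ) (θ : ℕ → ℝ) :
    ∑ k ∈ range (d + 1), sphericalCoord d θ k ^ 2 = 1 := by
  have h := abs_one_sub_sum_sphericalCoord_mul_le d θ θ
  simp only [sub_self, Real.cos_zero, Finset.sum_const_zero, ← sq] at h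
  linarith [abs_nonpos_iff.1 h]

lemma exists_eq_mul_sphericalCoord (d : ℕ) (y : ℕ → ℝ) :
    ∃ (r : ℝ) (θ : ℕ → ℝ), (1 ≤ d → 0 ≤ r) ∧ ∀ k ≤ d, y k = r * sphericalCoord d θ k := by
  induction d with
  | zero =>
    refine ⟨y 0, 0, by simp, fun k hk => ?_⟩
    obtain rfl : k = 0 := by omega
    simp [sphericalCoord]
  | succ d ih =>
    obtain ⟨r, θ, -, h⟩ := ih
    let z : ℂ := ⟨y (d + 1), r⟩
    have hcos : ‖z‖ * Real.cos z.arg = y (d + 1) := Complex.norm_mul_cos_arg z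
    have hsin : ‖z‖ * Real.sin z.arg = r := Complex.norm_mul_sin_arg z
    refine ⟨‖z‖, Function.update θ d z.arg, fun _ => norm_nonneg z, fun k hk => ?_⟩
    rcases Nat.le_succ_iff.1 hk with hk | rfl
    · rw [sphericalCoord_succ_of_le hk, h k hk, Function.update_self,
        sphericalCoord_congr hk fun j hj => Function.update_of_ne hj.ne z.arg θ]
      nth_rewrite 1 [← hsin]
      ring
    · rw [sphericalCoord_succ_self, Function.update_self, hcos]

lemma exists_sphericalCoord_eq {d : ℕ} (hd : 1 ≤ d) (y : Fin (d + 1) → ℝ)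
    (hy : ∑ k, y k ^ 2 = 1) : ∃ θ : ℕ → ℝ, ∀ k : Fin (d + 1), y k = sphericalCoord d θ k := by
  obtain ⟨r, θ, hr, h⟩ :=
    exists_eq_mul_sphericalCoord d fun k => if hk : k < d + 1 then y ⟨k, hk⟩ else 0
  have h' (k : Fin (d + 1)) : y k = r * sphericalCoord d θ k := by
    simpa [Nat.lt_succ_iff.1 k.2] using h k (Nat.lt_succ_iff.1 k.2)
  have hr2 : r ^ 2 = 1 := by
    simp only [h', mul_pow] at hy
    rwa [← Finset.mul_sum, Fin.sum_univ_eq_sum_range (fun k => sphericalCoord d θ k ^ 2),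
      sum_sphericalCoord_sq, mul_one] at hy
  have hr1 : r = 1 := (pow_eq_one_iff_of_nonneg (hr hd) two_ne_zero).1 hr2
  exact ⟨θ, fun k => by rw [h', hr1, one_mul]⟩

lemma exists_forall_abs_pow_mul_sub_le {l : ℕ} (hl : 0 < l) {p : ℝ} (hp : 0 < p) (n : ℕ)
    (φ : ℕ → ℝ) :
    ∃ γ ∈ Set.Ico 0 p, ∀ j < n, ∃ m : ℤ, |(l : ℝ) ^ j * γ - φ j - m * p| ≤ p / l := by
  have hl' : (0 : ℝ) < l := Nat.cast_pos.2 hl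
  induction n generalizing φ with
  | zero => exact ⟨0, ⟨le_rfl, hp⟩, by simp⟩
  | succ n ih =>
    obtain ⟨t, ⟨ht0, htp⟩, ht⟩ := ih fun j => φ (j + 1)
    obtain ⟨q, ⟨hq0, hq1⟩, -⟩ := existsUnique_add_zsmul_mem_Ico hp (φ 0) 0
    rw [zsmul_eq_mul] at hq0 hq1
    set a : ℝ := φ 0 + q * p with ha
    have hx0 : 0 ≤ l * a / p := by positivity
    set m : ℕ := ⌊l * a / p⌋₊ with hm
    have hm1 : m * p ≤ l * a := (le_div_iff₀ hp).1 (Nat.floor_le hx0)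
    have hm2 : l * a < (m + 1) * p := (div_lt_iff₀ hp).1 (Nat.lt_floor_add_one _)
    have hml : (m : ℝ) + 1 ≤ l := by
      have : m < l := by
        refine (Nat.floor_lt hx0).2 ((div_lt_iff₀ hp).2 ?_)
        exact mul_lt_mul_of_pos_left (by linarith) hl'
      exact_mod_cast this
    have hγ : (l : ℝ) * ((t + m * p) / l) = t + m * p := by field_simp
    refine ⟨(t + m * p) / l, ⟨by positivity, ?_⟩, fun j hj => ?_⟩
    · rw [div_lt_iff₀ hl']
      nlinarith
    · cases j with
      | zero =>
        refine ⟨q, ?_⟩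
        rw [le_div_iff₀ hl', ← abs_of_pos hl', ← abs_mul, abs_of_pos hl', abs_le]
        have : ((l : ℝ) ^ 0 * ((t + m * p) / l) - φ 0 - q * p) * l = t + m * p - l * a := by
          rw [sub_mul, sub_mul, pow_zero, one_mul, mul_comm _ (l : ℝ), hγ, ha]; ring
        rw [this]
        constructor <;> linarith
      | succ j =>
        obtain ⟨i, hi⟩ := ht j (by omega)
        refine ⟨i + m * l ^ j, ?_⟩
        have : (l : ℝ) ^ (j + 1) * ((t + m * p) / l) = l ^ j * t + m * l ^ j * p := by
          rw [pow_succ, mul_assoc, hγ]; ring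
        rw [this]
        convert hi using 2
        push_cast
        ring

lemma sum_mul_curveX_le_one {d : ℕ} (l : ℕ) (γ : ℝ) {y : Fin (d + 1) → ℝ}
    (hy : ∑ k, y k ^ 2 = 1) : ∑ k, y k * curveX d l γ k ≤ 1 := by
  have hx : ∑ k, curveX d l γ k ^ 2 = 1 := by
    simp only [curveX_eq_sphericalCoord]
    rw [Fin.sum_univ_eq_sum_range
      (fun k => sphericalCoord d (fun j => (l : ℝ) ^ j * γ) k ^ 2), sum_sphericalCoord_sq]
  have h : ∑ k, 2 * (y k * curveX d l γ k) ≤ ∑ k, (y k ^ 2 + curveX d l γ k ^ 2) :=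
    Finset.sum_le_sum fun k _ => by rw [← mul_assoc]; exact two_mul_le_add_sq _ _
  rw [← Finset.mul_sum, Finset.sum_add_distrib, hx, hy] at h
  linarith

lemma exists_le_sum_mul_curveX {d : ℕ} (hd : 1 ≤ d) {l : ℕ} (hl : 0 < l) {y : Fin (d + 1) → ℝ}
    (hy : ∑ k, y k ^ 2 = 1) :
    ∃ γ ∈ Set.Icc 0 (2 * Real.pi),
      1 - d * ((2 * Real.pi / l) ^ 2 / 2) ≤ ∑ k, y k * curveX d l γ k := by
  obtain ⟨φ, hφ⟩ := exists_sphericalCoord_eq hd y hy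
  obtain ⟨γ, hγ, h⟩ := exists_forall_abs_pow_mul_sub_le hl Real.two_pi_pos d φ
  refine ⟨γ, Set.Ico_subset_Icc_self hγ, ?_⟩
  have hI := abs_one_sub_sum_sphericalCoord_mul_le d φ fun j => (l : ℝ) ^ j * γ
  have hcos : ∑ j ∈ range d, (1 - Real.cos (φ j - (l : ℝ) ^ j * γ)) ≤
      ∑ _j ∈ range d, (2 * Real.pi / l) ^ 2 / 2 := by
    refine Finset.sum_le_sum fun j hj => ?_
    obtain ⟨m, hm⟩ := h j (Finset.mem_range.1 hj)
    rw [← Real.cos_neg, neg_sub, ← Real.cos_sub_int_mul_two_pi _ m]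
    have h2 := sq_le_sq' (abs_le.1 hm).1 (abs_le.1 hm).2
    linarith [Real.one_sub_sq_div_two_le_cos
      (x := (l : ℝ) ^ j * γ - φ j - m * (2 * Real.pi))]
  simp only [hφ, curveX_eq_sphericalCoord]
  rw [Fin.sum_univ_eq_sum_range
    (fun k => sphericalCoord d φ k * sphericalCoord d (fun j => (l : ℝ) ^ j * γ) k)]
  rw [Finset.sum_const, Finset.card_range, nsmul_eq_mul] at hcos
  linarith [le_abs_self (1 - ∑ k ∈ range (d + 1),
    sphericalCoord d φ k * sphericalCoord d (fun j => (l : ℝ) ^ j * γ) k)]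

/-- `inf_{y ∈ 𝕊} sup_{γ ∈ [0,2π]} yᵀx̃_γ → 1` as `λ → ∞`. -/
theorem inf_sup_inner_tendsto_one {d : ℕ} (hd : 1 ≤ d) :
    Tendsto
      (fun l : ℕ =>
        ⨅ y : {y : Fin (d + 1) → ℝ // ∑ k, y k ^ 2 = 1},
          ⨆ γ : Set.Icc (0 : ℝ) (2 * Real.pi),
            ∑ k, (y : Fin (d + 1) → ℝ) k * curveX d l (γ : ℝ) k)
      atTop (nhds 1) := by
  have : Nonempty {y : Fin (d + 1) → ℝ // ∑ k, y k ^ 2 = 1} := ⟨⟨Pi.single 0 1, by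
    simp [Pi.single_apply, ite_pow]⟩⟩
  have : Nonempty (Set.Icc (0 : ℝ) (2 * Real.pi)) := ⟨⟨0, le_rfl, Real.two_pi_pos.le⟩⟩
  have hlow {l : ℕ} (hl : 0 < l) (y : {y : Fin (d + 1) → ℝ // ∑ k, y k ^ 2 = 1}) :
      1 - d * ((2 * Real.pi / l) ^ 2 / 2) ≤ ⨆ γ : Set.Icc (0 : ℝ) (2 * Real.pi),
        ∑ k, (y : Fin (d + 1) → ℝ) k * curveX d l (γ : ℝ) k := by
    obtain ⟨γ, hγ, h⟩ := exists_le_sum_mul_curveX hd hl y.2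
    refine le_ciSup_of_le ⟨1, ?_⟩ ⟨γ, hγ⟩ h
    rintro _ ⟨γ, rfl⟩
    exact sum_mul_curveX_le_one l γ y.2
  have hlim : Tendsto (fun l : ℕ => 1 - d * ((2 * Real.pi / l) ^ 2 / 2)) atTop (nhds 1) := by
    simpa using (((tendsto_const_div_atTop_nhds_zero_nat (2 * Real.pi)).pow 2).div_const
      2).const_mul (d : ℝ) |>.const_sub 1
  refine tendsto_of_tendsto_of_tendsto_of_le_of_le' hlim tendsto_const_nhds ?_ ?_
  · filter_upwards [eventually_gt_atTop 0] with l hl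
    exact le_ciInf (hlow hl)
  · filter_upwards [eventually_gt_atTop 0] with l hl
    refine ciInf_le_of_le ⟨1 - d * ((2 * Real.pi / l) ^ 2 / 2), ?_⟩ (Classical.arbitrary _)
      (ciSup_le fun γ => sum_mul_curveX_le_one l γ (Classical.arbitrary _ : {y : Fin (d + 1) → ℝ // ∑ k, y k ^ 2 = 1}).2)
    rintro _ ⟨y, rfl⟩
    exact hlow hl y
end
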